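/- arXiv:2206.10712 — 2 statements merged into one kernel-verified Lean document; each statement's English description precedes it below -/
import Mathlib

section
/- Let G be a countable MIF group. Then the set of ℓ ∈ L(G) such that ℓ is a word length and, for every n ∈ ℕ, every tuple ā = (a₁,…,aₙ) ∈ Gⁿ and every tuple d̄ = (d₁,…,dₙ) ∈ ℕⁿ which is (ℓ,ā)-consistent, there exists g ∈ G with ℓ(g⁻¹aᵢ) = dᵢ for all i, is comeager in L(G). (Consequently, the Cayley graph of G associated to a generic length function satisfies Moss's Extension Property.) -/
open Set Function Pointwise

section Defs

variable {G : Type*} [Group G]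

/-- A length function on a group. -/
def IsLengthFun (ℓ : G → ℕ) : Prop :=
  (∀ g : G, ℓ g = 0 ↔ g = 1) ∧ (∀ g : G, ℓ g⁻¹ = ℓ g) ∧ ∀ g h : G, ℓ (g * h) ≤ ℓ g + ℓ h

/-- The space of length functions, topologized as a subspace of `G → ℕ`. -/
abbrev LengthFun (G : Type*) [Group G] : Type _ := {ℓ : G → ℕ // IsLengthFun ℓ}

/-- Word length with respect to a generating set `X`. -/
noncomputable def wordLength (X : Set G) (g : G) : ℕ :=
  sInf {n : ℕ | ∃ w : List G, w.length = n ∧ (∀ x ∈ w, x ∈ X ∨ x⁻¹ ∈ X) ∧ w.prod = g}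

/-- A length function is a word length. -/
def IsWordLength (ℓ : G → ℕ) : Prop :=
  ∃ X : Set G, Subgroup.closure X = ⊤ ∧ ∀ g : G, ℓ g = wordLength X g

/-- Mixed identity free group. -/
def MIF (G : Type*) [Group G] : Prop :=
  ∀ w : Monoid.Coprod G (FreeGroup Unit), w ≠ 1 →
    ∃ g : G, Monoid.Coprod.lift (MonoidHom.id G) (FreeGroup.lift fun _ => g) w ≠ 1

/-- The length function associated to a weight function `ω`. -/
noncomputable def weightLength (ω : G → ℕ) (g : G) : ℕ :=
  sInf {N : ℕ | ∃ w : List (G × Bool),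
    (w.map fun p => ω p.1).sum = N ∧
    (w.map fun p => if p.2 then p.1 else p.1⁻¹).prod = g}

/-- `(ℓ, a)`-consistency of a tuple of distances. -/
def Consistent (ℓ : G → ℕ) {n : ℕ} (a : Fin n → G) (d : Fin n → ℕ) : Prop :=
  ∀ i j : Fin n, d i ≤ ℓ ((a i)⁻¹ * a j) + d j ∧ ℓ ((a i)⁻¹ * a j) ≤ d i + d j

/-- The bi-Lipschitz preorder on length functions. -/
def Preceq (ℓ₁ ℓ₂ : G → ℕ) : Prop :=
  ∃ C : ℕ, ∀ g : G, g ≠ 1 → ℓ₁ g ≤ C * ℓ₂ g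

/-- The conjugacy action of `G` on its space of length functions. -/
def conjLF (g : G) (ℓ : LengthFun G) : LengthFun G :=
  ⟨fun x => ℓ.1 (g⁻¹ * x * g), by
    obtain ⟨h1, h2, h3⟩ := ℓ.2
    refine ⟨fun x => ?_, fun x => ?_, fun x y => ?_⟩
    · rw [h1]
      constructor
      · intro h
        have := congrArg (fun z => g * z * g⁻¹) h
        simpa [mul_assoc] using this
      · rintro rfl; simp
    · show ℓ.1 (g⁻¹ * x⁻¹ * g) = ℓ.1 (g⁻¹ * x * g)
      have h : g⁻¹ * x⁻¹ * g = (g⁻¹ * x * g)⁻¹ := by group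
      rw [h, h2]
    · show ℓ.1 (g⁻¹ * (x * y) * g) ≤ ℓ.1 (g⁻¹ * x * g) + ℓ.1 (g⁻¹ * y * g)
      have h : g⁻¹ * (x * y) * g = (g⁻¹ * x * g) * (g⁻¹ * y * g) := by group
      rw [h]
      exact h3 _ _⟩

/-- Topological transitivity of the conjugacy action on `LengthFun G`. -/
def ConjTopTransitive (G : Type*) [Group G] : Prop :=
  ∀ U V : Set (LengthFun G), IsOpen U → IsOpen V → U.Nonempty → V.Nonempty →
    ∃ g : G, ((conjLF g '' U) ∩ V).Nonempty

end Defs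

/-- The language with one binary function symbol and countably many unary predicates. -/
def lengthLang : FirstOrder.Language where
  Functions := fun n => match n with | 2 => Unit | _ => Empty
  Relations := fun n => match n with | 1 => ℕ | _ => Empty

/-- The `lengthLang`-structure on `G` associated to a length function `ℓ`. -/
def lengthStructure {G : Type*} [Group G] (ℓ : G → ℕ) : lengthLang.Structure G where
  funMap {n} f x :=
    match n, f, x with
    | 2, _, x => x 0 * x 1
  RelMap {n} r x :=
    match n, r, x with
    | 1, i, x => ℓ (x 0) = i

namespace Monoid.CoprodI

open NeWord

theorem NeWord.prod_ne_one {ι : Type*} {K : ι → Type*} [∀ i, Group (K i)] {i j : ι}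
    (w : NeWord K i j) : w.prod ≠ 1 := by
  classical
  intro h
  have h' : w.toWord = Word.empty := by
    apply Word.equiv.symm.injective
    exact h
  exact w.toList_ne_nil (congrArg Word.toList h')

variable {K : Bool → Type*} [∀ b, Group (K b)]

/-- If `K true` has at least three elements and `K false` is nontrivial, every nontrivial element
of the free product has a conjugate whose reduced word starts and ends in `K true`. -/
theorem exists_conj_eq_neWord_true (h3 : ∀ y : K true, ∃ x, x ≠ 1 ∧ x ≠ y)
    {u : CoprodI K} (hu : u ≠ 1) :
    ∃ (s : CoprodI K) (w : NeWord K true true), w.prod = s * u * s⁻¹ := by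
  classical
  have key : ∀ w : NeWord K true false, ∃ (s : CoprodI K) (w' : NeWord K true true),
      w'.prod = s * w.prod * s⁻¹ := by
    intro w
    obtain ⟨x, hx1, hx⟩ := h3 w.head⁻¹
    have hx' : x * w.head ≠ 1 := fun h => hx (eq_inv_of_mul_eq_one_left h)
    exact ⟨of x, (w.mulHead x hx').append (by decide) (singleton x⁻¹ (inv_ne_one.mpr hx1)),
      by simp⟩
  have hne : Word.equiv u ≠ Word.empty := by
    intro h
    apply hu
    apply Word.equiv.injective
    rw [h]
    exact (Word.equiv.apply_symm_apply Word.empty).symm.trans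
      (congrArg Word.equiv Word.prod_empty)
  obtain ⟨i, j, w, hw⟩ := NeWord.of_word _ hne
  have hwu : w.prod = u := by
    rw [NeWord.prod, hw]
    exact Word.equiv.symm_apply_apply u
  subst hwu
  match i, j, w with
  | true, true, w => exact ⟨1, w, by simp⟩
  | true, false, w => exact key w
  | false, true, w =>
    obtain ⟨s, w', h⟩ := key w.inv
    exact ⟨s, w'.inv, by simp [h, mul_assoc]⟩
  | false, false, w =>
    obtain ⟨x, hx1, -⟩ := h3 1
    exact ⟨of x, ((singleton x hx1).append (by decide) w).append (by decide)
      (singleton x⁻¹ (inv_ne_one.mpr hx1)), by simp⟩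

theorem exists_commutator_conj_ne_one (h3 : ∀ y : K true, ∃ x, x ≠ 1 ∧ x ≠ y)
    (h2 : Nontrivial (K false)) {u v : CoprodI K} (hu : u ≠ 1) (hv : v ≠ 1) :
    ∃ s t : CoprodI K,
      (s * u * s⁻¹) * (t * v * t⁻¹) * (s * u * s⁻¹)⁻¹ * (t * v * t⁻¹)⁻¹ ≠ 1 := by
  obtain ⟨s, w, hw⟩ := exists_conj_eq_neWord_true h3 hu
  obtain ⟨t, w', hw'⟩ := exists_conj_eq_neWord_true h3 hv
  obtain ⟨a, ha⟩ := exists_ne (1 : K false)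
  let w₁ : NeWord K false false := ((singleton a ha).append (by decide) w).append (by decide)
    (singleton a⁻¹ (inv_ne_one.mpr ha))
  let w₂ : NeWord K false true :=
    ((w₁.append (by decide) w').append (by decide) w₁.inv).append (by decide) w'.inv
  refine ⟨of a * s, t, ?_⟩
  convert w₂.prod_ne_one using 1
  simp [w₂, w₁, hw, hw', mul_assoc]

end Monoid.CoprodI

namespace Monoid.Coprod

/-- The family of the two factors of a binary free product. -/
abbrev factor (A B : Type) (b : Bool) : Type := cond b B A

instance (A B : Type) [Group A] [Group B] : ∀ b, Group (factor A B b)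
  | true => inferInstanceAs (Group B)
  | false => inferInstanceAs (Group A)

/-- The inclusions of the two factors in their binary free product. -/
def factorHom (A B : Type) [Group A] [Group B] : ∀ b, factor A B b →* Monoid.Coprod A B
  | true => (Monoid.Coprod.inr : B →* Monoid.Coprod A B)
  | false => (Monoid.Coprod.inl : A →* Monoid.Coprod A B)

/-- The canonical map from the binary free product to the indexed one. -/
def toCoprodI (A B : Type) [Group A] [Group B] :
    Monoid.Coprod A B →* Monoid.CoprodI (factor A B) :=
  Monoid.Coprod.lift (Monoid.CoprodI.of (M := factor A B) (i := false))
    (Monoid.CoprodI.of (M := factor A B) (i := true))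

/-- The binary free product as an indexed free product. -/
def equivCoprodI (A B : Type) [Group A] [Group B] :
    Monoid.Coprod A B ≃* Monoid.CoprodI (factor A B) :=
  MonoidHom.toMulEquiv
    (toCoprodI A B)
    (Monoid.CoprodI.lift (factorHom A B))
    (by
      apply Monoid.Coprod.hom_ext <;> ext x
      · exact Monoid.CoprodI.lift_of (M := factor A B) (N := Monoid.Coprod A B) (i := false)
          (factorHom A B) x
      · exact Monoid.CoprodI.lift_of (M := factor A B) (N := Monoid.Coprod A B) (i := true)
          (factorHom A B) x)
    (by
      apply Monoid.CoprodI.ext_hom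
      rintro (_ | _) <;> ext x
      · exact congrArg (toCoprodI A B) (Monoid.CoprodI.lift_of (M := factor A B)
          (N := Monoid.Coprod A B) (i := false) (factorHom A B) x)
      · exact congrArg (toCoprodI A B) (Monoid.CoprodI.lift_of (M := factor A B)
          (N := Monoid.Coprod A B) (i := true) (factorHom A B) x))

theorem exists_commutator_conj_ne_one {A B : Type} [Group A] [Group B] [Nontrivial A] [Infinite B]
    {u v : Monoid.Coprod A B} (hu : u ≠ 1) (hv : v ≠ 1) :
    ∃ s t : Monoid.Coprod A B,
      (s * u * s⁻¹) * (t * v * t⁻¹) * (s * u * s⁻¹)⁻¹ * (t * v * t⁻¹)⁻¹ ≠ 1 := by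
  classical
  let e := equivCoprodI A B
  obtain ⟨s, t, h⟩ := Monoid.CoprodI.exists_commutator_conj_ne_one (K := factor A B)
    (fun y => by
      obtain ⟨x, hx⟩ := Infinite.exists_notMem_finset ({(1 : B), y} : Finset B)
      simp only [Finset.mem_insert, Finset.mem_singleton, not_or] at hx
      exact ⟨x, hx⟩)
    (inferInstanceAs (Nontrivial A)) ((map_ne_one_iff e e.injective).mpr hu)
    ((map_ne_one_iff e e.injective).mpr hv)
  refine ⟨e.symm s, e.symm t, fun h' => h ?_⟩
  simpa using congrArg e h'

end Monoid.Coprod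

/-- Evaluation of words with coefficients in `G` at an element of `G`. -/
abbrev evalAt {G : Type} [Group G] (g : G) : Monoid.Coprod G (FreeGroup Unit) →* G :=
  Monoid.Coprod.lift (MonoidHom.id G) (FreeGroup.lift fun _ => g)

theorem MIF.nontrivial {G : Type} [Group G] (hG : MIF G) : Nontrivial G := by
  have h : (Monoid.Coprod.inr (FreeGroup.of ()) : Monoid.Coprod G (FreeGroup Unit)) ≠ 1 :=
    (map_ne_one_iff _ Monoid.Coprod.inr_injective).mpr (FreeGroup.of_ne_one ())
  obtain ⟨g, hg⟩ := hG _ h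
  exact ⟨g, 1, by simpa using hg⟩

/-- In a mixed identity free group, finitely many nontrivial words do not vanish simultaneously
at a suitable element. -/
theorem MIF.exists_forall_evalAt_ne_one {G : Type} [Group G] (hG : MIF G)
    {Q : Set (Monoid.Coprod G (FreeGroup Unit))} (hQ : Q.Finite) (h1 : ∀ w ∈ Q, w ≠ 1) :
    ∃ g : G, ∀ w ∈ Q, evalAt g w ≠ 1 := by
  have := hG.nontrivial
  suffices h : ∃ W : Monoid.Coprod G (FreeGroup Unit), W ≠ 1 ∧
      ∀ g : G, evalAt g W ≠ 1 → ∀ w ∈ Q, evalAt g w ≠ 1 by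
    obtain ⟨W, hW, h⟩ := h
    obtain ⟨g, hg⟩ := hG W hW
    exact ⟨g, h g hg⟩
  induction Q, hQ using Set.Finite.induction_on with
  | empty =>
    exact ⟨Monoid.Coprod.inr (FreeGroup.of ()),
      (map_ne_one_iff _ Monoid.Coprod.inr_injective).mpr (FreeGroup.of_ne_one ()), by simp⟩
  | @insert v Q _ _ ih =>
    obtain ⟨W, hW, h⟩ := ih fun w hw => h1 w (Set.mem_insert_of_mem _ hw)
    obtain ⟨s, t, hst⟩ :=
      Monoid.Coprod.exists_commutator_conj_ne_one (h1 v (Set.mem_insert _ _)) hW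
    refine ⟨_, hst, fun g hg w hw => ?_⟩
    rcases hw with rfl | hw
    · intro hv
      apply hg
      simp [hv]
    · refine h g (fun hW' => hg ?_) w hw
      simp [hW']

/-- `WeightReach P h n` means that `h` is a product of elements with costs allowed by `P` of total
cost `n`. -/
inductive WeightReach {G : Type} [Group G] (P : G → ℕ → Prop) : G → ℕ → Prop
  | one : WeightReach P 1 0
  | gen {h : G} {c : ℕ} : P h c → WeightReach P h c
  | mul {h k : G} {m n : ℕ} :
    WeightReach P h m → WeightReach P k n → WeightReach P (h * k) (m + n)

namespace WeightReach

variable {G : Type} [Group G] {P : G → ℕ → Prop}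

theorem inv (hP : ∀ h c, P h c → P h⁻¹ c) {h : G} {n : ℕ} (hn : WeightReach P h n) :
    WeightReach P h⁻¹ n := by
  induction hn with
  | one => simpa using one
  | gen hc => exact gen (hP _ _ hc)
  | mul _ _ ih₁ ih₂ => simpa [add_comm] using ih₂.mul ih₁

theorem eq_one (hpos : ∀ h c, P h c → 1 ≤ c) {h : G} (hn : WeightReach P h 0) : h = 1 := by
  generalize h0 : 0 = n at hn
  induction hn with
  | one => rfl
  | gen hc => have := hpos _ _ hc; omega
  | mul _ _ ih₁ ih₂ => rw [ih₁ (by omega), ih₂ (by omega), one_mul]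

theorem isLengthFun (hP : ∀ h c, P h c → P h⁻¹ c) (hpos : ∀ h c, P h c → 1 ≤ c)
    (hne : ∀ h, ∃ c, P h c) : IsLengthFun fun h : G => sInf {n | WeightReach P h n} := by
  have mem : ∀ h : G, WeightReach P h (sInf {n | WeightReach P h n}) := fun h =>
    Nat.sInf_mem (s := {n | WeightReach P h n}) ((hne h).imp fun _ => gen)
  refine ⟨fun g => ⟨fun hg => ?_, ?_⟩, fun g => ?_, fun g h => Nat.sInf_le ((mem g).mul (mem h))⟩
  · have := mem g
    simp only at hg
    rw [hg] at this
    exact eq_one hpos this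
  · rintro rfl
    exact Nat.le_zero.mp (Nat.sInf_le one)
  · apply le_antisymm
    · exact Nat.sInf_le ((mem g).inv hP)
    · exact Nat.sInf_le (by simpa using (mem g⁻¹).inv hP)

end WeightReach

/-- Let `D w n` express that `w` has pseudolength at most `n` in `H`. If `π : H →* G` is injective
on products of few elements of the finite set `T`, there is a length function on `G` assigning to
`π u` the pseudolength of `u`, for all `u ∈ T`. -/
theorem exists_lengthFun_of_injOn {G H : Type} [Group G] [Group H] (π : H →* G)
    (D : H → ℕ → Prop) (D_one : D 1 0) (D_inv : ∀ u n, D u n → D u⁻¹ n)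
    (D_mul : ∀ u v m n, D u m → D v n → D (u * v) (m + n))
    (T : Set (H × ℕ)) (M : ℕ) (hM : 1 ≤ M)
    (hT : ∀ p ∈ T, 1 ≤ p.2 ∧ p.2 ≤ M ∧ D p.1 p.2 ∧ ∀ n, D p.1 n → p.2 ≤ n)
    (hinj : ∀ w ∈ (insert 1 (Prod.fst '' T ∪ (Prod.fst '' T)⁻¹)) ^ (M + 1), π w = 1 → w = 1) :
    ∃ ℓ : LengthFun G, ∀ p ∈ T, ℓ.1 (π p.1) = p.2 := by
  set S : Set H := insert 1 (Prod.fst '' T ∪ (Prod.fst '' T)⁻¹) with hS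
  have S_one : (1 : H) ∈ S := Set.mem_insert _ _
  have S_mem : ∀ p ∈ T, p.1 ∈ S := fun p hp => Or.inr (Or.inl ⟨p, hp, rfl⟩)
  have S_inv : ∀ p ∈ T, p.1⁻¹ ∈ S := fun p hp => Or.inr (Or.inr ⟨p, hp, by simp⟩)
  let P : G → ℕ → Prop := fun h c =>
    (∃ p ∈ T, (h = π p.1 ∨ h = (π p.1)⁻¹) ∧ c = p.2) ∨ c = M
  have hP : ∀ h c, P h c → P h⁻¹ c := by
    rintro h c (⟨p, hp, h1 | h1, h2⟩ | h1)
    · exact Or.inl ⟨p, hp, Or.inr (by rw [h1]), h2⟩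
    · exact Or.inl ⟨p, hp, Or.inl (by rw [h1, inv_inv]), h2⟩
    · exact Or.inr h1
  have hpos : ∀ h c, P h c → 1 ≤ c := by
    rintro h c (⟨p, hp, -, rfl⟩ | rfl)
    · exact (hT p hp).1
    · exact hM
  have hne : ∀ h, ∃ c, P h c := fun h => ⟨M, Or.inr rfl⟩
  have lift : ∀ h n, WeightReach P h n → n < M → ∃ w ∈ S ^ n, π w = h ∧ D w n := by
    intro h n hn
    induction hn with
    | one => exact fun _ => ⟨1, by simp, map_one _, D_one⟩
    | @gen h c hc =>
      intro hlt
      have hsub : S ⊆ S ^ c := by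
        simpa using Set.pow_subset_pow_right S_one (hpos h c hc)
      rcases hc with ⟨p, hp, h1 | h1, rfl⟩ | rfl
      · exact ⟨p.1, hsub (S_mem p hp), h1.symm, (hT p hp).2.2.1⟩
      · exact ⟨p.1⁻¹, hsub (S_inv p hp), by rw [map_inv, h1], D_inv _ _ (hT p hp).2.2.1⟩
      · omega
    | mul _ _ ih₁ ih₂ =>
      intro hlt
      obtain ⟨w₁, hw₁, h₁, D₁⟩ := ih₁ (by omega)
      obtain ⟨w₂, hw₂, h₂, D₂⟩ := ih₂ (by omega)
      exact ⟨w₁ * w₂, by rw [pow_add]; exact Set.mul_mem_mul hw₁ hw₂, by rw [map_mul, h₁, h₂],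
        D_mul _ _ _ _ D₁ D₂⟩
  refine ⟨⟨_, WeightReach.isLengthFun hP hpos hne⟩, fun p hp => le_antisymm ?_ ?_⟩
  · exact Nat.sInf_le (WeightReach.gen (Or.inl ⟨p, hp, Or.inl rfl, rfl⟩))
  · refine le_csInf ((hne _).imp fun _ => WeightReach.gen) fun n hn => ?_
    by_contra hlt
    rw [not_le] at hlt
    have hpM := (hT p hp).2.1
    obtain ⟨w, hw, hπ, hD⟩ := lift _ n hn (by omega)
    have hmem : w * p.1⁻¹ ∈ S ^ (M + 1) := by
      refine Set.pow_subset_pow_right S_one (show n + 1 ≤ M + 1 by omega) ?_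
      rw [pow_succ]
      exact Set.mul_mem_mul hw (S_inv p hp)
    have heq : w = p.1 :=
      mul_inv_eq_one.mp (hinj _ hmem (by rw [map_mul, hπ, map_inv, mul_inv_cancel]))
    rw [heq] at hD
    have := (hT p hp).2.2.2 n hD
    omega

/-- `SupDistLE y z n` means that the functions `y` and `z` are at uniform distance at most `n`. -/
def SupDistLE {X : Type} (y z : X → ℤ) (n : ℕ) : Prop := ∀ k, |y k - z k| ≤ n

namespace SupDistLE

variable {X : Type} {x y z : X → ℤ} {m n : ℕ}

theorem symm (h : SupDistLE y z n) : SupDistLE z y n := fun k => by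
  rw [abs_sub_comm]
  exact h k

theorem trans (h₁ : SupDistLE x y m) (h₂ : SupDistLE y z n) : SupDistLE x z (m + n) := fun k => by
  have := abs_sub_le (x k) (y k) (z k)
  have := h₁ k
  have := h₂ k
  push_cast
  linarith

end SupDistLE

/-- The group of permutations of `X → ℤ` preserving the uniform distance. -/
def supIsometry (X : Type) : Subgroup (Equiv.Perm (X → ℤ)) where
  carrier := {σ | ∀ y z n, SupDistLE (σ y) (σ z) n ↔ SupDistLE y z n}
  one_mem' := fun _ _ _ => Iff.rfl
  mul_mem' := fun hσ hτ y z n => (hσ _ _ n).trans (hτ y z n)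
  inv_mem' := fun {σ} hσ y z n => by
    have := hσ (σ⁻¹ y) (σ⁻¹ z) n
    simpa using this.symm

/-- Translation of integer-valued functions, as an isometry for the uniform distance. -/
def supTranslate {X : Type} (v : X → ℤ) : supIsometry X :=
  ⟨Equiv.addRight v, fun y z n => by simp [SupDistLE]⟩

/-- Left translation of the argument, as a homomorphism to isometries for the uniform distance. -/
def supShift (G : Type) [Group G] : G →* supIsometry G where
  toFun g := ⟨(Equiv.mulLeft g).arrowCongr (Equiv.refl ℤ), fun y z n => by
    refine ⟨fun h k => ?_, fun h k => h _⟩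
    simpa using h (g * k)⟩
  map_one' := by
    ext y k
    exact congrArg y (show (1 : G)⁻¹ * k = k by simp)
  map_mul' g h := by
    ext y k
    exact congrArg y (show (g * h)⁻¹ * k = h⁻¹ * (g⁻¹ * k) by simp [mul_assoc])

theorem supShift_apply {G : Type} [Group G] (g : G) (y : G → ℤ) (k : G) :
    (supShift G g).1 y k = y (g⁻¹ * k) := rfl

/-- A length function on `G` extends to a pseudolength on `G ∗ ⟨x⟩`, described by the relation
`D w n` saying that `w` has pseudolength at most `n`, with prescribed consistent values at the
elements `x⁻¹ * a i`. -/
theorem exists_pseudolength_extension {G : Type} [Group G] (ℓ : LengthFun G) {n : ℕ} (hn : n ≠ 0)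
    (a : Fin n → G) (d : Fin n → ℕ) (hd : Consistent ℓ.1 a d) :
    ∃ D : Monoid.Coprod G (FreeGroup Unit) → ℕ → Prop,
      D 1 0 ∧ (∀ u n, D u n → D u⁻¹ n) ∧
      (∀ u v m n, D u m → D v n → D (u * v) (m + n)) ∧
      (∀ g n, D (Monoid.Coprod.inl g) n ↔ ℓ.1 g ≤ n) ∧
      ∀ i n, D ((Monoid.Coprod.inr (FreeGroup.of ()))⁻¹ * Monoid.Coprod.inl (a i)) n ↔ d i ≤ n := by
  obtain ⟨ℓ, hℓ1, hℓinv, hℓmul⟩ := ℓ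
  simp only at hd ⊢
  have : Nonempty (Fin n) := ⟨⟨0, Nat.pos_of_ne_zero hn⟩⟩
  have hmin : ∀ k : G, ∃ r : ℕ, (∃ i, r = ℓ (k⁻¹ * a i) + d i) ∧ ∀ i, r ≤ ℓ (k⁻¹ * a i) + d i := by
    intro k
    obtain ⟨i, hi⟩ := Finite.exists_min fun i => ℓ (k⁻¹ * a i) + d i
    exact ⟨_, ⟨i, rfl⟩, hi⟩
  choose f hf hfle using hmin
  let p : G → ℤ := fun k => ℓ k⁻¹
  let x : supIsometry G := supTranslate fun k => (f k : ℤ) - p k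
  let Φ : Monoid.Coprod G (FreeGroup Unit) →* supIsometry G :=
    Monoid.Coprod.lift (supShift G) (FreeGroup.lift fun _ => x)
  have hx : ∀ k, x.1 p k = f k := fun k => by simp [x, supTranslate]
  have hshift : ∀ h k, (supShift G h).1 p k = ℓ (k⁻¹ * h) := fun h k => by
    simp [supShift_apply, p]
  have hℓone : ℓ 1 = 0 := (hℓ1 1).mpr rfl
  have habs : ∀ b c r : ℕ, |(b : ℤ) - c| ≤ r ↔ b ≤ c + r ∧ c ≤ b + r := fun b c r => by
    rw [abs_le]; omega
  refine ⟨fun w n => SupDistLE ((Φ w).1 p) p n, ?_, ?_, ?_, ?_, ?_⟩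
  · intro k
    simp
  · intro u n h
    refine SupDistLE.symm ?_
    rw [← (Φ u).2]
    simpa using h
  · intro u v m n hu hv
    rw [add_comm m n]
    refine SupDistLE.trans ?_ hu
    rw [map_mul]
    exact ((Φ u).2 _ _ _).mpr hv
  · intro g n
    constructor
    · intro h
      have := h g
      rw [show Φ (Monoid.Coprod.inl g) = supShift G g from rfl, hshift, habs, inv_mul_cancel, hℓone,
        hℓinv] at this
      omega
    · intro h k
      rw [show Φ (Monoid.Coprod.inl g) = supShift G g from rfl, hshift, habs]
      have h1 := hℓmul k⁻¹ g
      have h2 := hℓmul (k⁻¹ * g) g⁻¹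
      rw [mul_inv_cancel_right, hℓinv g] at h2
      omega
  · intro i n
    have hiff : SupDistLE ((Φ ((Monoid.Coprod.inr (FreeGroup.of ()))⁻¹ *
        Monoid.Coprod.inl (a i))).1 p) p n ↔ ∀ k, |(ℓ (k⁻¹ * a i) : ℤ) - f k| ≤ n := by
      rw [← x.2]
      have h1 : Φ ((Monoid.Coprod.inr (FreeGroup.of ()))⁻¹ * Monoid.Coprod.inl (a i)) =
          x⁻¹ * supShift G (a i) := by simp [Φ]
      rw [h1]
      refine forall_congr' fun k => ?_
      rw [hx, ← hshift]
      simp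
    refine hiff.trans ?_
    constructor
    · intro h
      have h1 := h (a i)
      obtain ⟨j, hj⟩ := hf (a i)
      rw [habs, inv_mul_cancel, hℓone] at h1
      have := (hd i j).1
      omega
    · intro h k
      rw [habs]
      obtain ⟨j, hj⟩ := hf k
      have h1 := hfle k i
      have h2 := hℓmul (k⁻¹ * a j) ((a j)⁻¹ * a i)
      rw [mul_assoc, mul_inv_cancel_left] at h2
      have h3 := (hd j i).2
      omega

/-- In a mixed identity free group, any finite part of a length function can be kept while
realizing a consistent tuple of positive distances. -/
theorem MIF.exists_lengthFun_realizing {G : Type} [Group G] (hG : MIF G) (ℓ : LengthFun G)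
    (F : Finset G) {n : ℕ} (a : Fin n → G) (d : Fin n → ℕ)
    (hd : Consistent ℓ.1 a d) :
    ∃ ℓ' : LengthFun G, (∀ h ∈ F, ℓ'.1 h = ℓ.1 h) ∧ ∃ g : G, ∀ i, ℓ'.1 (g⁻¹ * a i) = d i := by
  classical
  rcases eq_or_ne n 0 with rfl | hn
  · exact ⟨ℓ, fun _ _ => rfl, 1, fun i => i.elim0⟩
  by_cases hd0 : ∃ i, d i = 0
  · obtain ⟨i, hi⟩ := hd0
    refine ⟨ℓ, fun _ _ => rfl, a i, fun j => ?_⟩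
    have h1 := (hd i j).2
    have h2 := (hd j i).1
    rw [← ℓ.2.2.1, mul_inv_rev, inv_inv] at h2
    omega
  rw [not_exists] at hd0
  obtain ⟨D, D_one, D_inv, D_mul, D_inl, D_x⟩ := exists_pseudolength_extension ℓ hn a d hd
  let T : Set (Monoid.Coprod G (FreeGroup Unit) × ℕ) :=
    (fun h : G => (Monoid.Coprod.inl h, ℓ.1 h)) '' (F.erase 1 : Finset G) ∪
    range fun i => ((Monoid.Coprod.inr (FreeGroup.of ()))⁻¹ * Monoid.Coprod.inl (a i), d i)
  have T_fin : T.Finite := ((Finset.finite_toSet _).image _).union (Set.finite_range _)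
  obtain ⟨M, hM⟩ := (T_fin.image Prod.snd).bddAbove
  let S := insert 1 (Prod.fst '' T ∪ (Prod.fst '' T)⁻¹)
  have S_fin : S.Finite := ((T_fin.image _).union (T_fin.image _).inv).insert _
  have hpow : (S ^ (M + 1 + 1)).Finite := by
    induction M + 1 + 1 with
    | zero => simp
    | succ m ih => exact pow_succ S m ▸ ih.mul S_fin
  obtain ⟨g, hg⟩ := hG.exists_forall_evalAt_ne_one (Q := S ^ (M + 1 + 1) \ {1})
    (hpow.subset Set.sdiff_subset) fun w hw => hw.2
  obtain ⟨ℓ', hℓ'⟩ := exists_lengthFun_of_injOn (evalAt g) D D_one D_inv D_mul T (M + 1)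
    (by omega) (fun q hq => by
      have hle : q.2 ≤ M := hM ⟨q, hq, rfl⟩
      rcases hq with ⟨h, hh, rfl⟩ | ⟨i, rfl⟩
      · refine ⟨?_, by omega, (D_inl _ _).mpr le_rfl, fun n => (D_inl _ _).mp⟩
        rw [Nat.one_le_iff_ne_zero]
        exact fun h0 => Finset.ne_of_mem_erase hh ((ℓ.2.1 h).mp h0)
      · exact ⟨Nat.one_le_iff_ne_zero.mpr (hd0 i), by omega, (D_x _ _).mpr le_rfl,
          fun n => (D_x _ _).mp⟩)
    fun w hw h1 => by_contra fun hw1 => hg w ⟨hw, hw1⟩ h1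
  refine ⟨ℓ', fun h hh => ?_, g, fun i => ?_⟩
  · by_cases h1 : h = 1
    · rw [h1, (ℓ'.2.1 1).mpr rfl, (ℓ.2.1 1).mpr rfl]
    · simpa using hℓ' _ (Or.inl ⟨h, Finset.mem_coe.mpr (Finset.mem_erase.mpr ⟨h1, hh⟩), rfl⟩)
  · simpa using hℓ' _ (Or.inr ⟨i, rfl⟩)

theorem wordLength_le {G : Type} [Group G] {X : Set G} (w : List G)
    (hw : ∀ x ∈ w, x ∈ X ∨ x⁻¹ ∈ X) : wordLength X w.prod ≤ w.length :=
  Nat.sInf_le ⟨w, rfl, hw, rfl⟩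

/-- A length function for which every element of length `n + 1` is a product of elements of lengths
`1` and `n` is a word length. -/
theorem IsLengthFun.isWordLength {G : Type} [Group G] {ℓ : G → ℕ} (hℓ : IsLengthFun ℓ)
    (h : ∀ g n, ℓ g = n + 1 → ∃ x, ℓ x = 1 ∧ ℓ (x⁻¹ * g) = n) : IsWordLength ℓ := by
  obtain ⟨h1, h_inv, h_mul⟩ := hℓ
  have key : ∀ n g, ℓ g = n →
      ∃ w : List G, w.length = n ∧ (∀ x ∈ w, ℓ x = 1) ∧ w.prod = g := by
    intro n
    induction n with
    | zero => exact fun g hg => ⟨[], rfl, by simp, by simp [(h1 g).mp hg]⟩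
    | succ n ih =>
      intro g hg
      obtain ⟨x, hx, hxg⟩ := h g n hg
      obtain ⟨w, hw, hwx, hwp⟩ := ih _ hxg
      exact ⟨x :: w, by simp [hw], by simpa [hx] using hwx, by simp [hwp]⟩
  have le_length : ∀ w : List G, (∀ x ∈ w, ℓ x = 1 ∨ ℓ x⁻¹ = 1) → ℓ w.prod ≤ w.length := by
    intro w
    induction w with
    | nil => simp [(h1 1).mpr rfl]
    | cons x w ih =>
      intro hw
      rw [List.forall_mem_cons, h_inv, or_self] at hw
      have := ih hw.2
      have := h_mul x w.prod
      rw [List.prod_cons, List.length_cons]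
      omega
  refine ⟨{x | ℓ x = 1}, ?_, fun g => ?_⟩
  · rw [eq_top_iff]
    intro g _
    obtain ⟨w, -, hw, rfl⟩ := key _ g rfl
    exact Subgroup.list_prod_mem _ fun x hx => Subgroup.subset_closure (hw x hx)
  · obtain ⟨w, hw, hw1, hwp⟩ := key _ g rfl
    apply le_antisymm
    · refine le_csInf ⟨_, w, hw, fun x hx => Or.inl (hw1 x hx), hwp⟩ ?_
      rintro _ ⟨w', rfl, hw', rfl⟩
      exact le_length w' hw'
    · have := wordLength_le (X := {x | ℓ x = 1}) w fun x hx => Or.inl (hw1 x hx)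
      rwa [hw, hwp] at this

theorem isOpen_realizing {G : Type} [Group G] {n : ℕ} (a : Fin n → G) (d : Fin n → ℕ) :
    IsOpen {ℓ : LengthFun G | Consistent ℓ.1 a d → ∃ g : G, ∀ i, ℓ.1 (g⁻¹ * a i) = d i} := by
  have hc : ∀ {ι : Type} [Finite ι] (c : ι → G) (A : Set (ι → ℕ)),
      IsOpen {ℓ : LengthFun G | (fun i => ℓ.1 (c i)) ∈ A} := fun c A =>
    (isOpen_discrete A).preimage
      (continuous_pi fun i => (continuous_apply (c i)).comp continuous_subtype_val)
  simp only [imp_iff_not_or, Set.ofPred_or]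
  refine IsOpen.union ?_ ?_
  · exact hc (fun q : Fin n × Fin n => (a q.1)⁻¹ * a q.2)
      {r | ¬ ∀ i j, d i ≤ r (i, j) + d j ∧ r (i, j) ≤ d i + d j}
  · have : {ℓ : LengthFun G | ∃ g : G, ∀ i, ℓ.1 (g⁻¹ * a i) = d i} =
        ⋃ g : G, {ℓ : LengthFun G | ∀ i, ℓ.1 (g⁻¹ * a i) = d i} := by
      ext
      simp
    exact this ▸ isOpen_iUnion fun g => hc (fun i => g⁻¹ * a i) {r | ∀ i, r i = d i}

theorem MIF.dense_realizing {G : Type} [Group G] (hG : MIF G) {n : ℕ} (a : Fin n → G)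
    (d : Fin n → ℕ) :
    Dense {ℓ : LengthFun G | Consistent ℓ.1 a d → ∃ g : G, ∀ i, ℓ.1 (g⁻¹ * a i) = d i} := by
  intro ℓ
  by_cases hd : Consistent ℓ.1 a d
  swap
  · exact subset_closure fun h => absurd h hd
  rw [mem_closure_iff]
  rintro _ ⟨O, hO, rfl⟩ hℓ
  obtain ⟨F, u, hu, hF⟩ := isOpen_pi_iff.mp hO _ hℓ
  obtain ⟨ℓ', h1, h2⟩ := hG.exists_lengthFun_realizing ℓ F a d hd
  refine ⟨ℓ', hF fun h hh => ?_, fun _ => h2⟩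
  rw [h1 h hh]
  exact (hu h hh).2

theorem stmt2 (G : Type) [Group G] [Countable G] (hG : MIF G) :
    {ℓ : LengthFun G | IsWordLength ℓ.1 ∧
      ∀ (n : ℕ) (a : Fin n → G) (d : Fin n → ℕ), Consistent ℓ.1 a d →
        ∃ g : G, ∀ i : Fin n, ℓ.1 (g⁻¹ * a i) = d i} ∈ residual (LengthFun G) := by
  have ext_property : ∀ᶠ ℓ : LengthFun G in residual (LengthFun G),
      ∀ (n : ℕ) (a : Fin n → G) (d : Fin n → ℕ), Consistent ℓ.1 a d →
        ∃ g : G, ∀ i : Fin n, ℓ.1 (g⁻¹ * a i) = d i := by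
    refine eventually_countable_forall.mpr fun n => eventually_countable_forall.mpr fun a =>
      eventually_countable_forall.mpr fun d => ?_
    exact residual_of_dense_open (isOpen_realizing a d) (hG.dense_realizing a d)
  filter_upwards [ext_property] with ℓ hℓ
  refine ⟨ℓ.2.isWordLength fun g n hg => ?_, hℓ⟩
  have h1 : ℓ.1 1 = 0 := (ℓ.2.1 1).mpr rfl
  have h_inv := ℓ.2.2.1
  obtain ⟨x, hx⟩ := hℓ 2 ![1, g] ![1, n] fun i j => by
    fin_cases i <;> fin_cases j <;> simp [h1, h_inv, hg] <;> omega
  refine ⟨x, ?_, by simpa using hx 1⟩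
  simpa [h_inv] using hx 0
end

section
/- Let G be a countably infinite group. Every comeager subset D of L(G) contains a subset S of cardinality 2^{ℵ₀} (the cardinality of the continuum) such that any two distinct elements ℓ₁, ℓ₂ ∈ S are ≼-incomparable, i.e., neither ℓ₁ ≼ ℓ₂ nor ℓ₂ ≼ ℓ₁ holds. -/
open Set Function Pointwise

open Topology

/-- In a finite power of a metric space, the tuples whose coordinates at two distinct indices
form a pair in a dense set are dense. -/
theorem Dense.setOf_apply_pair_mem {X ι : Type*} [MetricSpace X] [Fintype ι]
    {E : Set (X × X)} (hE : Dense E) {i j : ι} (hij : i ≠ j) :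
    Dense {q : ι → X | (q i, q j) ∈ E} := by
  classical
  rw [Metric.dense_iff]
  intro q r hr
  obtain ⟨⟨a, b⟩, hab, hE'⟩ := Metric.dense_iff.1 hE (q i, q j) r hr
  rw [Metric.mem_ball, Prod.dist_eq, max_lt_iff] at hab
  refine ⟨update (update q i a) j b, ?_, ?_⟩
  · rw [Metric.mem_ball, dist_pi_lt_iff hr]
    intro k
    by_cases hkj : k = j
    · subst hkj; simpa using hab.2
    · by_cases hki : k = i
      · subst hki; simpa [hkj] using hab.1
      · simpa [hkj, hki] using hr
  · simpa [hij] using hE'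

/-- One refinement step in the construction of a Cantor scheme all of whose pairs of distinct
nodes lie in a prescribed dense open relation. -/
theorem exists_refinement {X : Type*} [MetricSpace X] [CompleteSpace X]
    {E : Set (X × X)} (hEo : IsOpen E) (hEd : Dense E) (n : ℕ)
    (p : (Fin n → Bool) → X) {ε : ℝ} (hε : 0 < ε) :
    ∃ (q : (Fin (n + 1) → Bool) → X) (δ : ℝ), 0 < δ ∧ δ ≤ ε / 2 ∧
      (∀ σ, Metric.closedBall (q σ) δ ⊆
        Metric.closedBall (p fun i => σ i.castSucc) ε) ∧
      ∀ σ τ, σ ≠ τ → Metric.closedBall (q σ) δ ×ˢ Metric.closedBall (q τ) δ ⊆ E := by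
  let T := {s : (Fin (n + 1) → Bool) × (Fin (n + 1) → Bool) // s.1 ≠ s.2}
  let A : T → Set ((Fin (n + 1) → Bool) → X) := fun s => {q | (q s.1.1, q s.1.2) ∈ E}
  have hAo : ∀ s, IsOpen (A s) := fun s => hEo.preimage (by fun_prop)
  have hA : Dense (⋂ s, A s) :=
    dense_iInter_of_isOpen hAo fun s => hEd.setOf_apply_pair_mem s.2
  obtain ⟨q, hqp, hqA⟩ :=
    Metric.dense_iff.1 hA (fun σ => p fun i => σ i.castSucc) (ε / 2) (by positivity)
  obtain ⟨r, hr, hrA⟩ :=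
    Metric.isOpen_iff.1 (isOpen_iInter_of_finite hAo) q hqA
  rw [Metric.mem_ball, dist_pi_lt_iff (by positivity)] at hqp
  refine ⟨q, min (ε / 2) (r / 2), by positivity, min_le_left _ _, fun σ => ?_, ?_⟩
  · refine Metric.closedBall_subset_closedBall' ?_
    have := hqp σ
    have := min_le_left (ε / 2) (r / 2)
    linarith
  · classical
    rintro σ τ hστ ⟨a, b⟩ ⟨ha, hb⟩
    rw [Metric.mem_closedBall] at ha hb
    have hm := min_le_right (ε / 2) (r / 2)
    have hmem : update (update q σ a) τ b ∈ Metric.ball q r := by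
      rw [Metric.mem_ball, dist_pi_lt_iff hr]
      intro k
      by_cases hkj : k = τ
      · subst hkj
        simp only [update_self]
        linarith
      · by_cases hki : k = σ
        · subst hki
          simp only [update_of_ne hkj, update_self]
          linarith
        · simpa [hkj, hki] using hr
    have := Set.mem_iInter.1 (hrA hmem) ⟨(σ, τ), hστ⟩
    simpa [A, hστ] using this

/-- **Mycielski's theorem** for binary relations, on complete metric spaces. -/
theorem exists_pairwise_mem_of_mem_residual {X : Type*} [MetricSpace X] [CompleteSpace X]
    [Nonempty X] {M : Set (X × X)} (hM : M ∈ residual (X × X)) :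
    ∃ f : (ℕ → Bool) → X, Pairwise fun x y => (f x, f y) ∈ M := by
  obtain ⟨S, hSo, hSd, hSc, hSM⟩ := mem_residual_iff.1 hM
  obtain ⟨E, hE⟩ := (hSc.insert univ).exists_eq_range (insert_nonempty _ _)
  have hE' : ∀ k, IsOpen (E k) ∧ Dense (E k) := by
    intro k
    have hk : E k ∈ insert univ S := hE ▸ mem_range_self k
    rcases hk with hk | hk
    · rw [hk]
      exact ⟨isOpen_univ, dense_univ⟩
    · exact ⟨hSo _ hk, hSd _ hk⟩
  have hOo : ∀ n, IsOpen (⋂ k : Fin (n + 1), E k) :=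
    fun n => isOpen_iInter_of_finite fun k => (hE' k).1
  have hOd : ∀ n, Dense (⋂ k : Fin (n + 1), E k) :=
    fun n => dense_iInter_of_isOpen (fun k => (hE' k).1) fun k => (hE' k).2
  choose q δ hδ hδε hsub hpair using fun (n : ℕ) (p : (Fin n → Bool) → X) (ε : ℝ) (hε : 0 < ε) =>
    exists_refinement (hOo n) (hOd n) n p hε
  let P : (n : ℕ) → ((Fin n → Bool) → X) × {ε : ℝ // 0 < ε} := fun n =>
    Nat.rec (motive := fun n => ((Fin n → Bool) → X) × {ε : ℝ // 0 < ε})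
      (fun _ => Classical.arbitrary X, ⟨1, one_pos⟩)
      (fun n s => (q n s.1 s.2.1 s.2.2, ⟨δ n s.1 s.2.1 s.2.2, hδ n s.1 s.2.1 s.2.2⟩)) n
  let B : (ℕ → Bool) → ℕ → Set X := fun x n =>
    Metric.closedBall ((P n).1 fun i => x i) (P n).2
  have hBanti : ∀ x, Antitone (B x) := fun x => antitone_nat_of_succ_le fun n =>
    hsub n (P n).1 (P n).2.1 (P n).2.2 fun i => x i
  have hε : ∀ n, ((P n).2 : ℝ) ≤ 2 / 2 / 2 ^ n := by
    intro n
    induction n with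
    | zero => simp [P]
    | succ n ih =>
      refine (hδε n (P n).1 (P n).2.1 (P n).2.2).trans ?_
      calc ((P n).2 : ℝ) / 2 ≤ 2 / 2 / 2 ^ n / 2 := by gcongr
        _ = 2 / 2 / 2 ^ (n + 1) := by rw [pow_succ]; field_simp
  have hmem : ∀ x n, ((P n).1 fun i => x i) ∈ B x n := fun x n =>
    Metric.mem_closedBall_self (P n).2.2.le
  have hlim : ∀ x, ∃ a, ∀ n, a ∈ B x n := by
    intro x
    have hc : CauchySeq fun n => (P n).1 fun i => x i := by
      refine cauchySeq_of_le_geometric_two (C := 2) fun n => ?_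
      rw [dist_comm]
      exact (Metric.mem_closedBall.1 (hBanti x n.le_succ (hmem x (n + 1)))).trans (hε n)
    obtain ⟨a, ha⟩ := cauchySeq_tendsto_of_complete hc
    refine ⟨a, fun n => Metric.isClosed_closedBall.mem_of_tendsto ha ?_⟩
    filter_upwards [Filter.eventually_ge_atTop n] with m hm
    exact hBanti x hm (hmem x m)
  choose f hf using hlim
  refine ⟨f, fun x y hxy => hSM fun t ht => ?_⟩
  obtain ⟨k, rfl⟩ : t ∈ range E := hE ▸ mem_insert_of_mem _ ht
  obtain ⟨m, hm⟩ := Function.ne_iff.1 hxy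
  let n := max k m
  have hne : (fun i : Fin (n + 1) => x i) ≠ fun i : Fin (n + 1) => y i := fun h =>
    hm (congrFun h ⟨m, Nat.lt_succ_of_le (le_max_right k m)⟩)
  have := hpair n (P n).1 (P n).2.1 (P n).2.2 _ _ hne (mk_mem_prod (hf x (n + 1)) (hf y (n + 1)))
  exact Set.mem_iInter.1 this ⟨k, Nat.lt_succ_of_le (le_max_left k m)⟩

section LengthFun

variable {G : Type*} [Group G]

theorem isClosed_setOf_isLengthFun : IsClosed {ℓ : G → ℕ | IsLengthFun ℓ} := by
  have h (g : G) : Continuous fun ℓ : G → ℕ => ℓ g := continuous_apply g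
  simp only [IsLengthFun, Set.ofPred_and, Set.ofPred_forall]
  refine IsClosed.inter (isClosed_iInter fun g => ?_)
    (IsClosed.inter (isClosed_iInter fun g => isClosed_eq (h _) (h _))
      (isClosed_iInter fun g => isClosed_iInter fun k => isClosed_le (h _) ((h _).add (h _))))
  exact (isClosed_discrete {m : ℕ | m = 0 ↔ g = 1}).preimage (h g)

theorem isLengthFun_indicator [DecidableEq G] : IsLengthFun fun g : G => if g = 1 then 0 else 1 := by
  refine ⟨fun g => by simp, fun g => by simp, fun g h => ?_⟩
  by_cases hg : g = 1
  · simp [hg]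
  · simp only [hg, if_false]
    split_ifs <;> omega

theorem IsLengthFun.min_const {ℓ : G → ℕ} (hℓ : IsLengthFun ℓ) {K : ℕ} (hK : 0 < K) :
    IsLengthFun fun g => min (ℓ g) K := by
  obtain ⟨h1, h2, h3⟩ := hℓ
  refine ⟨fun g => ?_, fun g => by simp only [h2], fun g h => ?_⟩
  · rw [← h1 g]
    dsimp only
    omega
  · have := h3 g h
    dsimp only
    omega

/-- The largest subadditive function vanishing at `1` and bounded by the weight `ω`. -/
noncomputable def infWeight (ω : G → ℕ) (g : G) : ℕ :=
  sInf {N : ℕ | ∃ w : List G, w.prod = g ∧ (w.map ω).sum = N}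

theorem exists_list_infWeight (ω : G → ℕ) (g : G) :
    ∃ w : List G, w.prod = g ∧ (w.map ω).sum = infWeight ω g :=
  Nat.sInf_mem (s := {N : ℕ | ∃ w : List G, w.prod = g ∧ (w.map ω).sum = N})
    ⟨_, [g], by simp, rfl⟩

theorem infWeight_prod_le (ω : G → ℕ) (w : List G) : infWeight ω w.prod ≤ (w.map ω).sum :=
  Nat.sInf_le ⟨w, rfl, rfl⟩

theorem infWeight_le (ω : G → ℕ) (g : G) : infWeight ω g ≤ ω g := by
  simpa using infWeight_prod_le ω [g]

theorem IsLengthFun.prod_le {ℓ : G → ℕ} (hℓ : IsLengthFun ℓ) (w : List G) :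
    ℓ w.prod ≤ (w.map ℓ).sum := by
  induction w with
  | nil => simp [(hℓ.1 1).2 rfl]
  | cons a w ih =>
    simp only [List.prod_cons, List.map_cons, List.sum_cons]
    exact (hℓ.2.2 _ _).trans (by omega)

theorem IsLengthFun.le_infWeight {ℓ ω : G → ℕ} (hℓ : IsLengthFun ℓ) (hω : ∀ g, ℓ g ≤ ω g)
    (g : G) : ℓ g ≤ infWeight ω g := by
  obtain ⟨w, rfl, hw⟩ := exists_list_infWeight ω g
  rw [← hw]
  exact (hℓ.prod_le w).trans (List.sum_le_sum fun i _ => hω i)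

theorem IsLengthFun.infWeight {ℓ ω : G → ℕ} (hℓ : IsLengthFun ℓ) (hω : ∀ g, ℓ g ≤ ω g)
    (hinv : ∀ g, ω g⁻¹ = ω g) : IsLengthFun (infWeight ω) := by
  have hle (g : G) : _root_.infWeight ω g⁻¹ ≤ _root_.infWeight ω g := by
    obtain ⟨w, rfl, hw⟩ := exists_list_infWeight ω g
    rw [← hw, List.prod_inv_reverse]
    refine (infWeight_prod_le _ _).trans_eq ?_
    simp [List.sum_reverse, comp_def, hinv]
  refine ⟨fun g => ⟨fun h => ?_, ?_⟩, fun g => le_antisymm (hle g) ?_, fun g h => ?_⟩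
  · have := hℓ.le_infWeight hω g
    exact (hℓ.1 g).1 (by omega)
  · rintro rfl
    simpa using infWeight_prod_le ω []
  · simpa using hle g⁻¹
  · obtain ⟨v, rfl, hv⟩ := exists_list_infWeight ω g
    obtain ⟨w, rfl, hw⟩ := exists_list_infWeight ω h
    rw [← hv, ← hw, ← List.prod_append, ← List.sum_append, ← List.map_append]
    exact infWeight_prod_le _ _

/-- If a positive weight is at least `N` off a finite set, then `infWeight` is less than `N`
at only finitely many elements. -/
theorem finite_setOf_infWeight_lt {ω : G → ℕ} {F : Set G} (hF : F.Finite) {N : ℕ}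
    (hpos : ∀ g, 0 < ω g) (hN : ∀ g ∉ F, N ≤ ω g) : {g | infWeight ω g < N}.Finite := by
  have := hF.to_subtype
  refine ((List.finite_length_lt F N).image fun w => (w.map Subtype.val).prod).subset fun g hg => ?_
  obtain ⟨w, rfl, hw⟩ := exists_list_infWeight ω g
  rw [Set.mem_ofPred_eq, ← hw] at hg
  have hwF : ∀ x ∈ w, x ∈ F := fun x hx => by
    by_contra h
    have := List.single_le_sum (l := w.map ω) (by simp) (ω x) (List.mem_map_of_mem hx)
    have := hN x h
    omega
  have hlen : w.length ≤ (w.map ω).sum := by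
    simpa using List.length_le_sum_of_one_le (w.map ω) (by
      intro i hi
      obtain ⟨x, -, rfl⟩ := List.mem_map.1 hi
      exact hpos x)
  lift w to List F using hwF
  exact ⟨w, by simpa using hlen.trans_lt hg, rfl⟩

/-- A length function on an infinite group can be changed off a finite set so as to exceed any
given bound at some element. -/
theorem IsLengthFun.exists_eqOn_lt [Infinite G] {ℓ : G → ℕ} (hℓ : IsLengthFun ℓ) {F : Set G}
    (hF : F.Finite) (N : ℕ) : ∃ ℓ', IsLengthFun ℓ' ∧ EqOn ℓ' ℓ F ∧ ∃ g, N < ℓ' g := by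
  classical
  let F' := F ∪ F⁻¹
  have hF' : F'.Finite := hF.union hF.inv
  let ω : G → ℕ := fun g => max (ℓ g) (if g ∈ F' then 1 else N + 1)
  have hmem (g : G) : g⁻¹ ∈ F' ↔ g ∈ F' := by simp [F', or_comm]
  have hω (g : G) : ℓ g ≤ ω g := le_max_left _ _
  have hlen : IsLengthFun (_root_.infWeight ω) :=
    hℓ.infWeight hω fun g => by simp only [ω, hℓ.2.1, hmem]
  refine ⟨_, hlen, fun g hg => ?_, ?_⟩
  · by_cases h1 : g = 1
    · rw [(hlen.1 g).2 h1, (hℓ.1 g).2 h1]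
    · refine le_antisymm ((infWeight_le ω g).trans ?_) (hℓ.le_infWeight hω g)
      have hgF : g ∈ F' := Or.inl hg
      have : ℓ g ≠ 0 := fun h => h1 ((hℓ.1 g).1 h)
      simp only [ω, hgF, if_true]
      omega
  · have hfin : {g | _root_.infWeight ω g < N + 1}.Finite := by
      refine finite_setOf_infWeight_lt hF' (fun g => ?_) fun g hg => ?_
      · simp only [ω]; split_ifs <;> omega
      · simp only [ω, hg, if_false]; omega
    obtain ⟨g, hg⟩ := hfin.exists_notMem
    exact ⟨g, by simpa using hg⟩

/-- Every neighbourhood of a length function contains all length functions agreeing with it on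
some finite set. -/
theorem LengthFun.exists_finite_of_mem_nhds {ℓ : LengthFun G} {U : Set (LengthFun G)}
    (hU : U ∈ 𝓝 ℓ) :
    ∃ F : Set G, F.Finite ∧ ∀ ℓ' : LengthFun G, EqOn ℓ'.1 ℓ.1 F → ℓ' ∈ U := by
  obtain ⟨V, hV, hVU⟩ := (mem_nhds_induced _ _ _).1 hU
  rw [nhds_pi, Filter.mem_pi] at hV
  obtain ⟨F, hF, t, ht, htV⟩ := hV
  refine ⟨F, hF, fun ℓ' h => hVU (htV fun g hg => ?_)⟩
  rw [h hg]
  exact mem_of_mem_nhds (ht g)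

theorem isOpen_setOf_exists_mul_lt (C : ℕ) :
    IsOpen {s : LengthFun G × LengthFun G | ∃ g, g ≠ 1 ∧ C * s.2.1 g < s.1.1 g} := by
  simp only [Set.ofPred_exists, Set.ofPred_and]
  refine isOpen_iUnion fun g => isOpen_const.inter (isOpen_lt ?_ ?_)
  · exact continuous_const.mul ((continuous_apply g).comp (continuous_subtype_val.comp continuous_snd))
  · exact (continuous_apply g).comp (continuous_subtype_val.comp continuous_fst)

theorem dense_setOf_exists_mul_lt [Infinite G] (C : ℕ) :
    Dense {s : LengthFun G × LengthFun G | ∃ g, g ≠ 1 ∧ C * s.2.1 g < s.1.1 g} := by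
  rintro ⟨ℓ₁, ℓ₂⟩
  rw [mem_closure_iff_nhds]
  intro U hU
  rw [nhds_prod_eq, Filter.mem_prod_iff] at hU
  obtain ⟨U₁, hU₁, U₂, hU₂, hUU⟩ := hU
  obtain ⟨F₁, hF₁, h₁⟩ := LengthFun.exists_finite_of_mem_nhds hU₁
  obtain ⟨F₂, hF₂, h₂⟩ := LengthFun.exists_finite_of_mem_nhds hU₂
  obtain ⟨K, hK⟩ := (hF₂.image ℓ₂.1).bddAbove
  obtain ⟨ℓ, hℓ, heq, g, hg⟩ := ℓ₁.2.exists_eqOn_lt hF₁ (C * (K + 1))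
  refine ⟨(⟨ℓ, hℓ⟩, ⟨_, ℓ₂.2.min_const K.succ_pos⟩),
    hUU (mk_mem_prod (h₁ _ heq) (h₂ _ fun x hx => ?_)), g, ?_, ?_⟩
  · have : ℓ₂.1 x ≤ K := hK (mem_image_of_mem _ hx)
    exact min_eq_left (by omega)
  · rintro rfl
    rw [(hℓ.1 1).2 rfl] at hg
    omega
  · exact (Nat.mul_le_mul_left C (min_le_right _ _)).trans_lt hg

theorem setOf_not_preceq_mem_residual [Infinite G] :
    {s : LengthFun G × LengthFun G | ¬Preceq s.1.1 s.2.1} ∈ residual (LengthFun G × LengthFun G) := by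
  have h : ⋂ C : ℕ, {s : LengthFun G × LengthFun G | ∃ g, g ≠ 1 ∧ C * s.2.1 g < s.1.1 g} ∈
      residual (LengthFun G × LengthFun G) := countable_iInter_mem.2 fun C =>
    residual_of_dense_open (isOpen_setOf_exists_mul_lt C) (dense_setOf_exists_mul_lt C)
  filter_upwards [h] with s hs
  rintro ⟨C, hC⟩
  obtain ⟨g, hg, hlt⟩ := Set.mem_iInter.1 hs C
  exact (hC g hg).not_gt hlt

end LengthFun

theorem stmt4 (G : Type) [Group G] [Countable G] [Infinite G]
    (D : Set (LengthFun G)) (hD : D ∈ residual (LengthFun G)) :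
    ∃ S : Set (LengthFun G), S ⊆ D ∧ Cardinal.mk S = Cardinal.continuum ∧
      ∀ ℓ₁ ∈ S, ∀ ℓ₂ ∈ S, ℓ₁ ≠ ℓ₂ → ¬Preceq ℓ₁.1 ℓ₂.1 ∧ ¬Preceq ℓ₂.1 ℓ₁.1 := by
  classical
  have : PolishSpace (LengthFun G) := isClosed_setOf_isLengthFun.polishSpace
  let := TopologicalSpace.upgradeIsCompletelyMetrizable (LengthFun G)
  have : Nonempty (LengthFun G) := ⟨⟨_, isLengthFun_indicator⟩⟩
  have hD' : Prod.fst ⁻¹' D ∈ residual (LengthFun G × LengthFun G) :=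
    tendsto_residual_of_isOpenMap continuous_fst isOpenMap_fst hD
  obtain ⟨f, hf⟩ := exists_pairwise_mem_of_mem_residual
    (Filter.inter_mem hD' setOf_not_preceq_mem_residual)
  have hinj : Injective f := fun x y hxy => by
    by_contra hne
    refine (hf hne).2 ⟨1, fun g _ => ?_⟩
    simp [hxy]
  refine ⟨range f, ?_, ?_, ?_⟩
  · rintro _ ⟨x, rfl⟩
    obtain ⟨y, hy⟩ := exists_ne x
    exact (hf hy.symm).1
  · rw [Cardinal.mk_range_eq f hinj]
    simp
  · rintro _ ⟨x, rfl⟩ _ ⟨y, rfl⟩ hne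
    have hxy : x ≠ y := fun h => hne (congrArg f h)
    exact ⟨(hf hxy).2, (hf hxy.symm).2⟩
end
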